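/- Let r2 : ℝ → ℝ³ be continuously differentiable with ‖r2' s‖ ≤ v1 for all s ∈ ℝ, where 0 ≤ v1 < 1. Then at every point (r1, t) of G the unit vector field e = r12/T is differentiable, with time derivative De = −u·e + u·z·e − u·z·v and spatial partial derivatives Dᵢe = −u·z·eᵢ·e + u·δᵢ + u·z·eᵢ·v for i = 1,2,3, where δᵢ denotes the i-th standard basis vector of ℝ³. -/

import Mathlib

open scoped RealInnerProductSpace

section RetardedTime

variable {E : Type*} [NormedAddCommGroup E]

/-- The retarded time of a trajectory of speed less than one is continuous. -/
theorem continuous_retardedTime {γ : ℝ → E} {c : ℝ} (hc : c < 1)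
    (hγ : ∀ s s', ‖γ s - γ s'‖ ≤ c * |s - s'|)
    {τ : E × ℝ → ℝ} (hτ : ∀ p, τ p = p.2 - ‖p.1 - γ (τ p)‖) : Continuous τ := by
  rw [continuous_iff_continuousAt]
  intro q
  have key : ∀ p, dist (τ p) (τ q) ≤ (1 - c)⁻¹ * (|p.2 - q.2| + ‖p.1 - q.1‖) := by
    intro p
    rw [Real.dist_eq, inv_mul_eq_div, le_div_iff₀ (by linarith)]
    have h1 : |‖q.1 - γ (τ q)‖ - ‖p.1 - γ (τ p)‖| ≤ ‖p.1 - q.1‖ + ‖γ (τ p) - γ (τ q)‖ := by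
      refine (abs_norm_sub_norm_le _ _).trans ?_
      rw [show q.1 - γ (τ q) - (p.1 - γ (τ p)) = (γ (τ p) - γ (τ q)) - (p.1 - q.1) by abel,
        add_comm]
      exact norm_sub_le _ _
    have h2 : |τ p - τ q| ≤ |p.2 - q.2| + |‖q.1 - γ (τ q)‖ - ‖p.1 - γ (τ p)‖| := by
      rw [show τ p - τ q = (p.2 - q.2) + (‖q.1 - γ (τ q)‖ - ‖p.1 - γ (τ p)‖) by
        linarith [hτ p, hτ q]]
      exact abs_add_le _ _
    linarith [hγ (τ p) (τ q)]
  rw [ContinuousAt, tendsto_iff_dist_tendsto_zero]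
  refine squeeze_zero (fun _ => dist_nonneg) key ?_
  have hcont : Continuous fun p : E × ℝ => (1 - c)⁻¹ * (|p.2 - q.2| + ‖p.1 - q.1‖) := by
    fun_prop
  simpa using hcont.tendsto q

variable [InnerProductSpace ℝ E]

/-- The derivative of `x ↦ ‖x‖` away from the origin. -/
theorem hasFDerivAt_norm_of_ne_zero {x : E} (hx : x ≠ 0) :
    HasFDerivAt (fun y : E => ‖y‖) (innerSL ℝ (‖x‖⁻¹ • x)) x := by
  have hn : ‖x‖ ≠ 0 := norm_ne_zero_iff.mpr hx
  have h := (hasStrictFDerivAt_norm_sq x).hasFDerivAt.sqrt (pow_ne_zero 2 hn)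
  simp only [Real.sqrt_sq (norm_nonneg _)] at h
  refine h.congr_fderiv ?_
  ext y
  simp
  field_simp

/-- The derivative of the retarded time off the trajectory. -/
theorem hasFDerivAt_retardedTime {γ : ℝ → E} {τ : E × ℝ → ℝ} {p : E × ℝ} {w e : E}
    (hτ : ∀ p, τ p = p.2 - ‖p.1 - γ (τ p)‖) (hcont : ContinuousAt τ p)
    (hγ : HasDerivAt γ w (τ p)) (hne : p.1 - γ (τ p) ≠ 0)
    (he : e = ‖p.1 - γ (τ p)‖⁻¹ • (p.1 - γ (τ p))) (hz : 1 - ⟪e, w⟫ ≠ 0) :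
    HasFDerivAt τ ((1 - ⟪e, w⟫)⁻¹ •
      (ContinuousLinearMap.snd ℝ E ℝ - (innerSL ℝ e).comp (ContinuousLinearMap.fst ℝ E ℝ))) p := by
  let A : E × ℝ →L[ℝ] E × ℝ := (ContinuousLinearMap.fst ℝ E ℝ).prod
    (ContinuousLinearMap.snd ℝ E ℝ + (innerSL ℝ e).comp (ContinuousLinearMap.fst ℝ E ℝ -
      (ContinuousLinearMap.snd ℝ E ℝ).smulRight w))
  let B : E × ℝ →L[ℝ] E × ℝ := (ContinuousLinearMap.fst ℝ E ℝ).prod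
    ((1 - ⟪e, w⟫)⁻¹ • (ContinuousLinearMap.snd ℝ E ℝ -
      (innerSL ℝ e).comp (ContinuousLinearMap.fst ℝ E ℝ)))
  have hBA : Function.LeftInverse B A := by
    rintro ⟨x, s⟩
    simp only [A, B, ContinuousLinearMap.prod_apply, ContinuousLinearMap.coe_fst',
      ContinuousLinearMap.coe_snd', add_apply, ContinuousLinearMap.comp_apply,
      sub_apply, smul_apply,
      ContinuousLinearMap.smulRight_apply, innerSL_apply_apply, inner_sub_right,
      real_inner_smul_right, smul_eq_mul, Prod.mk.injEq, true_and]
    field_simp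
    ring
  have hAB : Function.RightInverse B A := by
    rintro ⟨x, s⟩
    simp only [A, B, ContinuousLinearMap.prod_apply, ContinuousLinearMap.coe_fst',
      ContinuousLinearMap.coe_snd', add_apply, ContinuousLinearMap.comp_apply,
      sub_apply, smul_apply,
      ContinuousLinearMap.smulRight_apply, innerSL_apply_apply, inner_sub_right,
      real_inner_smul_right, smul_eq_mul, Prod.mk.injEq, true_and]
    field_simp
    ring
  let Φ : (E × ℝ) ≃L[ℝ] E × ℝ := ContinuousLinearEquiv.equivOfInverse A B hBA hAB
  have hF : HasFDerivAt (fun q : E × ℝ => (q.1, q.2 + ‖q.1 - γ q.2‖)) (Φ : E × ℝ →L[ℝ] E × ℝ)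
      (p.1, τ p) := by
    have hγ' : HasFDerivAt (fun q : E × ℝ => γ q.2)
        ((ContinuousLinearMap.snd ℝ E ℝ).smulRight w) (p.1, τ p) :=
      (hγ.hasFDerivAt.comp (p.1, τ p) hasFDerivAt_snd).congr_fderiv (by ext <;> simp)
    have hnorm := (hasFDerivAt_norm_of_ne_zero hne).comp (p.1, τ p) (hasFDerivAt_fst.sub hγ')
    rw [← he] at hnorm
    exact hasFDerivAt_fst.prodMk (hasFDerivAt_snd.add hnorm)
  have hinv : HasFDerivAt (fun q : E × ℝ => (q.1, τ q)) (Φ.symm : E × ℝ →L[ℝ] E × ℝ) p := by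
    refine HasFDerivAt.of_local_left_inverse (continuousAt_fst.prodMk hcont) hF ?_
    refine Filter.Eventually.of_forall fun q => Prod.ext rfl ?_
    change τ q + ‖q.1 - γ (τ q)‖ = q.2
    linarith [hτ q]
  exact hasFDerivAt_snd.comp p hinv

end RetardedTime

/-- differentiability of the unit vector field `e = r12/T` on `G`,
with `De = −u·e + u·z·e − u·z·v` and `Dᵢe = −u·z·eᵢ·e + u·δᵢ + u·z·eᵢ·v`. -/
theorem e_field_differential
    (r2 : ℝ → EuclideanSpace ℝ (Fin 3)) (v1 : ℝ)
    (hv0 : 0 ≤ v1) (hv1 : v1 < 1)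
    (hC1 : ContDiff ℝ 1 r2) (hbd : ∀ s : ℝ, ‖deriv r2 s‖ ≤ v1)
    (τ : EuclideanSpace ℝ (Fin 3) × ℝ → ℝ)
    (hτ : ∀ p : EuclideanSpace ℝ (Fin 3) × ℝ, τ p = p.2 - ‖p.1 - r2 (τ p)‖)
    (T : EuclideanSpace ℝ (Fin 3) × ℝ → ℝ)
    (hT : ∀ p, T p = p.2 - τ p)
    (u : EuclideanSpace ℝ (Fin 3) × ℝ → ℝ)
    (hu : ∀ p, u p = (T p)⁻¹)
    (e : EuclideanSpace ℝ (Fin 3) × ℝ → EuclideanSpace ℝ (Fin 3))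
    (he : ∀ p, e p = (T p)⁻¹ • (p.1 - r2 (τ p)))
    (v : EuclideanSpace ℝ (Fin 3) × ℝ → EuclideanSpace ℝ (Fin 3))
    (hv : ∀ p, v p = deriv r2 (τ p))
    (z : EuclideanSpace ℝ (Fin 3) × ℝ → ℝ)
    (hz : ∀ p, z p = (1 - ⟪e p, v p⟫)⁻¹)
    (r1 : EuclideanSpace ℝ (Fin 3)) (t : ℝ)
    (hG : 0 < T (r1, t)) :
    ∃ L : EuclideanSpace ℝ (Fin 3) × ℝ →L[ℝ] EuclideanSpace ℝ (Fin 3),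
      HasFDerivAt e L (r1, t) ∧
        ∀ (dr : EuclideanSpace ℝ (Fin 3)) (dt : ℝ),
          L (dr, dt) =
            dt • ((-(u (r1, t))) • e (r1, t) + (u (r1, t) * z (r1, t)) • e (r1, t)
                - (u (r1, t) * z (r1, t)) • v (r1, t)) +
              ∑ i : Fin 3, dr i •
                ((-(u (r1, t) * z (r1, t) * e (r1, t) i)) • e (r1, t)
                  + u (r1, t) • EuclideanSpace.single i (1 : ℝ)
                  + (u (r1, t) * z (r1, t) * e (r1, t) i) • v (r1, t)) := by
  have hlip : ∀ s s', ‖r2 s - r2 s'‖ ≤ v1 * |s - s'| := fun s s' =>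
    Convex.norm_image_sub_le_of_norm_deriv_le
      (fun x _ => hC1.differentiable one_ne_zero x) (fun x _ => hbd x) convex_univ
      (Set.mem_univ s') (Set.mem_univ s)
  have hTn : T (r1, t) = ‖r1 - r2 (τ (r1, t))‖ := by
    have := hτ (r1, t)
    rw [hT]
    dsimp only at this ⊢
    linarith
  have hne : r1 - r2 (τ (r1, t)) ≠ 0 := norm_pos_iff.mp (hTn ▸ hG)
  have hen : e (r1, t) = ‖r1 - r2 (τ (r1, t))‖⁻¹ • (r1 - r2 (τ (r1, t))) := by
    rw [he, hTn]
  have he1 : ‖e (r1, t)‖ = 1 := by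
    rw [hen]
    exact norm_smul_inv_norm (𝕜 := ℝ) hne
  have hz0 : 1 - ⟪e (r1, t), v (r1, t)⟫ ≠ 0 := by
    have h := real_inner_le_norm (e (r1, t)) (v (r1, t))
    rw [he1, one_mul, hv (r1, t)] at h
    rw [hv (r1, t)]
    linarith [hbd (τ (r1, t))]
  have hr2 : HasDerivAt r2 (v (r1, t)) (τ (r1, t)) := by
    rw [hv]
    exact (hC1.differentiable one_ne_zero _).hasDerivAt
  have hτ' := hasFDerivAt_retardedTime hτ (continuous_retardedTime hv1 hlip hτ).continuousAt
    hr2 hne hen hz0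
  rw [← hz] at hτ'
  have hT' : HasFDerivAt T (ContinuousLinearMap.snd ℝ _ ℝ - z (r1, t) •
      (ContinuousLinearMap.snd ℝ _ ℝ - (innerSL ℝ (e (r1, t))).comp
        (ContinuousLinearMap.fst ℝ _ ℝ))) (r1, t) := by
    rw [funext hT]
    exact HasFDerivAt.sub (hasFDerivAt_snd (𝕜 := ℝ)) hτ'
  have hTinv := (hasDerivAt_inv hG.ne').comp_hasFDerivAt (r1, t) hT'
  have hr12 : HasFDerivAt (fun p : EuclideanSpace ℝ (Fin 3) × ℝ => p.1 - r2 (τ p)) _ (r1, t) :=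
    hasFDerivAt_fst.sub (hr2.hasFDerivAt.comp (r1, t) hτ')
  have he' := (hTinv.smul hr12).congr_of_eventuallyEq (.of_forall he)
  refine ⟨_, he', fun dr dt => ?_⟩
  have hr : r1 - r2 (τ (r1, t)) = T (r1, t) • e (r1, t) := by
    rw [he, smul_inv_smul₀ hG.ne']
  have hu0 : u (r1, t) = (T (r1, t))⁻¹ := hu _
  have hin : ⟪e (r1, t), dr⟫ = ∑ i : Fin 3, dr i * e (r1, t) i := by
    simp [PiLp.inner_apply]
  ext j
  have hT0 := hG.ne'
  fin_cases j <;> simp [hr, hin, hu0, Fin.sum_univ_three] <;> field_simp <;> ring
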